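/- Let r ≥ 3 and write n = p(r+1) + q with 0 ≤ q < r+1. Then the maximum number of hyperedges in an n-vertex r-uniform hypergraph containing no Berge path of length r+1 equals p(r+1) + C(q,r). -/

import Mathlib

/-- A Berge path of length `k` in a hypergraph with hyperedge set `E`. -/
def IsBergePath {V : Type*} (E : Finset (Finset V)) (k : ℕ)
    (v : Fin (k + 1) → V) (h : Fin k → Finset V) : Prop :=
  Function.Injective v ∧ Function.Injective h ∧ (∀ i, h i ∈ E) ∧
    ∀ i : Fin k, v i.castSucc ∈ h i ∧ v i.succ ∈ h i

def HasBergePath {V : Type*} (E : Finset (Finset V)) (k : ℕ) : Prop :=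
  ∃ v h, IsBergePath E k v h

section BergePaths

variable {V : Type*} {E F : Finset (Finset V)} {k : ℕ} {v : ℕ → V} {g : ℕ → Finset V}

/-- A Berge path of length `k` indexed by natural numbers: the vertices are `v 0, …, v k` and
the hyperedges are `g 0, …, g (k - 1)`. -/
structure IsNatBergePath (E : Finset (Finset V)) (k : ℕ) (v : ℕ → V) (g : ℕ → Finset V) :
    Prop where
  vertex_inj : ∀ i j, i ≤ k → j ≤ k → v i = v j → i = j
  edge_inj : ∀ i j, i < k → j < k → g i = g j → i = j
  edge_mem : ∀ i, i < k → g i ∈ E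
  left_mem : ∀ i, i < k → v i ∈ g i
  right_mem : ∀ i, i < k → v (i + 1) ∈ g i

namespace IsNatBergePath

theorem hasBergePath (h : IsNatBergePath E k v g) : HasBergePath E k := by
  refine ⟨fun i => v i, fun i => g i, ?_, ?_, fun i => h.edge_mem i i.2, fun i => ?_⟩
  · intro i j hij
    exact Fin.ext (h.vertex_inj i j (by omega) (by omega) hij)
  · intro i j hij
    exact Fin.ext (h.edge_inj i j i.2 j.2 hij)
  · exact ⟨by simpa using h.left_mem i i.2, by simpa using h.right_mem i i.2⟩

theorem mono (h : IsNatBergePath E k v g) (hEF : E ⊆ F) : IsNatBergePath F k v g :=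
  ⟨h.vertex_inj, h.edge_inj, fun i hi => hEF (h.edge_mem i hi), h.left_mem, h.right_mem⟩

theorem reverse (h : IsNatBergePath E k v g) :
    IsNatBergePath E k (fun i => v (k - i)) (fun i => g (k - 1 - i)) := by
  refine ⟨?_, ?_, ?_, ?_, ?_⟩
  · intro i j hi hj hij
    have := h.vertex_inj _ _ (by omega) (by omega) hij
    omega
  · intro i j hi hj hij
    have := h.edge_inj _ _ (by omega) (by omega) hij
    omega
  · intro i hi
    exact h.edge_mem _ (by omega)
  · intro i hi
    have := h.right_mem (k - 1 - i) (by omega)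
    rwa [show k - 1 - i + 1 = k - i by omega] at this
  · intro i hi
    have := h.left_mem (k - 1 - i) (by omega)
    rwa [show k - 1 - i = k - (i + 1) by omega] at this ⊢

theorem cons (h : IsNatBergePath E k v g) {x : V} {e : Finset V} (hx : ∀ i ≤ k, x ≠ v i)
    (he : e ∈ E) (hge : ∀ i < k, e ≠ g i) (hxe : x ∈ e) (hve : v 0 ∈ e) :
    IsNatBergePath E (k + 1) (fun i => Nat.casesOn i x v) (fun i => Nat.casesOn i e g) := by
  refine ⟨?_, ?_, ?_, ?_, ?_⟩
  · rintro (_ | i) (_ | j) hi hj hij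
    · rfl
    · exact absurd hij (hx j (by omega))
    · exact absurd hij.symm (hx i (by omega))
    · rw [h.vertex_inj i j (by omega) (by omega) hij]
  · rintro (_ | i) (_ | j) hi hj hij
    · rfl
    · exact absurd hij (hge j (by omega))
    · exact absurd hij.symm (hge i (by omega))
    · rw [h.edge_inj i j (by omega) (by omega) hij]
  · rintro (_ | i) hi
    exacts [he, h.edge_mem i (by omega)]
  · rintro (_ | i) hi
    exacts [hxe, h.left_mem i (by omega)]
  · rintro (_ | i) hi
    exacts [hve, h.right_mem i (by omega)]

/-- Reversing the initial segment `v 0, …, v i` when `v 0 ∈ g i`. -/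
theorem reverse_prefix (h : IsNatBergePath E k v g) {i : ℕ} (hi : i < k) (hv : v 0 ∈ g i) :
    IsNatBergePath E k (fun j => if j ≤ i then v (i - j) else v j)
      (fun j => if j < i then g (i - 1 - j) else g j) := by
  refine ⟨?_, ?_, ?_, ?_, ?_⟩
  · intro a b ha hb hab
    split_ifs at hab <;> have := h.vertex_inj _ _ (by omega) (by omega) hab <;> omega
  · intro a b ha hb hab
    split_ifs at hab <;> have := h.edge_inj _ _ (by omega) (by omega) hab <;> omega
  · intro a ha
    split_ifs <;> exact h.edge_mem _ (by omega)
  · intro a ha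
    split_ifs with h1 h2 h3
    · have := h.right_mem (i - 1 - a) (by omega)
      rwa [show i - 1 - a + 1 = i - a by omega] at this
    · omega
    · obtain rfl : a = i := by omega
      simpa using hv
    · exact h.left_mem _ ha
  · intro a ha
    split_ifs with h1 h2 h3
    · have := h.left_mem (i - 1 - a) (by omega)
      rwa [show i - 1 - a = i - (a + 1) by omega] at this ⊢
    · omega
    · omega
    · exact h.right_mem _ ha

/-- The vertices of the path obtained from a chord `v (i + 1) ∈ g 0` by making `x ∈ g i` the
first vertex. -/
def rotVertex (v : ℕ → V) (i : ℕ) (x : V) (j : ℕ) : V :=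
  if j = 0 then x else if j ≤ i then v (i + 1 - j) else v j

/-- The hyperedges of the path with vertices `rotVertex v i x`. -/
def rotEdge (g : ℕ → Finset V) (i : ℕ) (j : ℕ) : Finset V :=
  if j ≤ i then g (i - j) else g j

/-- The path of `rotVertex` without its first vertex. -/
theorem rotate_tail (h : IsNatBergePath E (k + 1) v g) {i : ℕ} (hi : i ≤ k)
    (hv : v (i + 1) ∈ g 0) :
    IsNatBergePath E k (fun j => if j < i then v (i - j) else v (j + 1))
      (fun j => if j < i then g (i - 1 - j) else g (j + 1)) := by
  refine ⟨?_, ?_, ?_, ?_, ?_⟩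
  · intro a b ha hb hab
    split_ifs at hab <;> have := h.vertex_inj _ _ (by omega) (by omega) hab <;> omega
  · intro a b ha hb hab
    split_ifs at hab <;> have := h.edge_inj _ _ (by omega) (by omega) hab <;> omega
  · intro a ha
    split_ifs <;> exact h.edge_mem _ (by omega)
  · intro a ha
    split_ifs
    · have := h.right_mem (i - 1 - a) (by omega)
      rwa [show i - 1 - a + 1 = i - a by omega] at this
    · exact h.left_mem _ (by omega)
  · intro a ha
    split_ifs
    · have := h.left_mem (i - 1 - a) (by omega)
      rwa [show i - 1 - a = i - (a + 1) by omega] at this ⊢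
    · rwa [show i - 1 - a = 0 by omega, show a + 1 = i by omega]
    · omega
    · exact h.right_mem _ (by omega)

theorem rotate (h : IsNatBergePath E (k + 1) v g) {i : ℕ} (hi : i ≤ k) (hv : v (i + 1) ∈ g 0)
    {x : V} (hx : ∀ j, 1 ≤ j → j ≤ k + 1 → x ≠ v j) (hxg : x ∈ g i) :
    IsNatBergePath E (k + 1) (rotVertex v i x) (rotEdge g i) := by
  convert (h.rotate_tail hi hv).cons (x := x) (e := g i) ?_ (h.edge_mem i (by omega)) ?_ hxg ?_
    using 1
  · funext j
    cases j with
    | zero => rfl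
    | succ j => simp [rotVertex]
  · funext j
    cases j with
    | zero => simp [rotEdge]
    | succ j => simp [rotEdge, Nat.sub_sub, Nat.add_comm]
  · intro j hj
    split_ifs <;> exact hx _ (by omega) (by omega)
  · intro j hj
    split_ifs <;> intro hij <;> have := h.edge_inj _ _ (by omega) (by omega) hij <;> omega
  · split_ifs with h0
    · exact h.left_mem i (by omega)
    · obtain rfl : i = 0 := by omega
      exact h.right_mem 0 (by omega)

/-- A Berge path whose ends lie in a further hyperedge `e` closes up to a Berge cycle, which can
be opened at any of its vertices. -/
theorem open_cycle (h : IsNatBergePath E k v g) {e : Finset V} (he : e ∈ E)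
    (hge : ∀ i < k, e ≠ g i) (h0 : v 0 ∈ e) (hk : v k ∈ e) {j : ℕ} (hj : j < k) :
    ∃ v' g', IsNatBergePath E k v' g' ∧ v' 0 = v (j + 1) ∧ v' k = v j ∧
      (∀ i ≤ k, ∃ i' ≤ k, v' i = v i') ∧
      ∀ i < k, g' i = e ∨ ∃ i' < k, i' ≠ j ∧ g' i = g i' := by
  refine ⟨fun i => if i + j < k then v (j + 1 + i) else v (i + j - k),
    fun i => if i + j + 1 < k then g (j + 1 + i) else if i + j + 1 = k then e
      else g (i + j - k), ⟨?_, ?_, ?_, ?_, ?_⟩, ?_, ?_, ?_, ?_⟩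
  · intro a b ha hb hab
    split_ifs at hab <;> have := h.vertex_inj _ _ (by omega) (by omega) hab <;> omega
  · intro a b ha hb hab
    split_ifs at hab
    all_goals first
      | omega
      | exact absurd hab (hge _ (by omega))
      | exact absurd hab.symm (hge _ (by omega))
      | (have := h.edge_inj _ _ (by omega) (by omega) hab; omega)
  · intro a ha
    split_ifs
    exacts [h.edge_mem _ (by omega), he, h.edge_mem _ (by omega)]
  · intro a ha
    split_ifs
    all_goals first
      | omega
      | exact h.left_mem _ (by omega)
      | rwa [show j + 1 + a = k by omega]
  · intro a ha
    split_ifs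
    all_goals try omega
    · exact h.right_mem (j + 1 + a) (by omega)
    · rwa [show a + 1 + j - k = 0 by omega]
    · have := h.right_mem (a + j - k) (by omega)
      rwa [show a + j - k + 1 = a + 1 + j - k by omega] at this
  · simp [hj]
  · simp
  · intro i hi
    dsimp only
    split_ifs
    exacts [⟨_, by omega, rfl⟩, ⟨_, by omega, rfl⟩]
  · intro i hi
    dsimp only
    split_ifs
    exacts [Or.inr ⟨_, by omega, by omega, rfl⟩, Or.inl rfl, Or.inr ⟨_, by omega, by omega, rfl⟩]

end IsNatBergePath

/-- A Berge cycle of length `k + 1`, given as a Berge path of length `k` whose ends lie in a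
further hyperedge. -/
def HasBergeCycle (E : Finset (Finset V)) (k : ℕ) : Prop :=
  ∃ v g e, IsNatBergePath E k v g ∧ e ∈ E ∧ (∀ i < k, e ≠ g i) ∧ v 0 ∈ e ∧ v k ∈ e

/-- A family of `k + 1 ≤ r` hyperedges of size `r` that do not form a Berge cycle of length
`k + 1`. -/
structure IsAcyclicSystem (F : Finset (Finset V)) (k r : ℕ) : Prop where
  card_eq : F.card = k + 1
  le_size : k + 1 ≤ r
  uniform : ∀ e ∈ F, e.card = r
  not_cycle : ¬ HasBergeCycle F k

variable [DecidableEq V]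

theorem IsNatBergePath.image_edge (h : IsNatBergePath F k v g) (hF : F.card = k) :
    (Finset.range k).image g = F := by
  apply Finset.eq_of_subset_of_card_le
  · intro e he
    simp only [Finset.mem_image, Finset.mem_range] at he
    obtain ⟨i, hi, rfl⟩ := he
    exact h.edge_mem i hi
  · rw [Finset.card_image_of_injOn, Finset.card_range, hF]
    intro i hi j hj hij
    exact h.edge_inj i j (by simpa using hi) (by simpa using hj) hij

/-- The vertices `v 1, …, v k`. -/
def pathTail (v : ℕ → V) (k : ℕ) : Finset V := (Finset.Icc 1 k).image v

theorem mem_pathTail {x : V} : x ∈ pathTail v k ↔ ∃ j, 1 ≤ j ∧ j ≤ k ∧ v j = x := by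
  simp [pathTail, and_assoc]

/-- The part of `g i` outside `v 1, …, v k`. -/
def outer (v : ℕ → V) (g : ℕ → Finset V) (k i : ℕ) : Finset V := g i \ pathTail v k

/-- The indices `i` such that the path can be rotated to start with `g i`. -/
def chords (v : ℕ → V) (g : ℕ → Finset V) (k : ℕ) : Finset ℕ :=
  (Finset.range k).filter fun i => v (i + 1) ∈ g 0

/-- The chords whose outer part meets the outer part of an earlier chord. -/
def repeats (v : ℕ → V) (g : ℕ → Finset V) (k : ℕ) : Finset ℕ :=
  (chords v g k).filter
    fun i => ∃ j ∈ chords v g k, j < i ∧ ¬ Disjoint (outer v g k j) (outer v g k i)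

/-- The chords whose outer part is disjoint from the outer parts of all earlier chords. -/
def fresh (v : ℕ → V) (g : ℕ → Finset V) (k : ℕ) : Finset ℕ :=
  (chords v g k).filter
    fun i => ¬ ∃ j ∈ chords v g k, j < i ∧ ¬ Disjoint (outer v g k j) (outer v g k i)

open Classical in
/-- The possible first vertices of Berge paths of length `k` in `F` with last vertex `w`. -/
noncomputable def starts (F : Finset (Finset V)) (k : ℕ) (w : V) : Finset V :=
  (F.biUnion id).filter fun x => ∃ v g, IsNatBergePath F k v g ∧ v 0 = x ∧ v k = w

theorem exists_path_of_mem_starts {w x : V} (hx : x ∈ starts F k w) :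
    ∃ v g, IsNatBergePath F k v g ∧ v 0 = x ∧ v k = w := by
  classical
  rw [starts, Finset.mem_filter] at hx
  exact hx.2

theorem mem_outer {i : ℕ} {x : V} :
    x ∈ outer v g k i ↔ x ∈ g i ∧ ∀ j, 1 ≤ j → j ≤ k → x ≠ v j := by
  simp only [outer, Finset.mem_sdiff, mem_pathTail]
  refine and_congr_right fun _ => ⟨fun h j h1 h2 h3 => h ⟨j, h1, h2, h3.symm⟩, ?_⟩
  rintro h ⟨j, h1, h2, h3⟩
  exact h j h1 h2 h3.symm

theorem mem_chords {i : ℕ} : i ∈ chords v g k ↔ i < k ∧ v (i + 1) ∈ g 0 := by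
  simp [chords]

namespace IsNatBergePath

theorem mem_starts (h : IsNatBergePath F (k + 1) v g) : v 0 ∈ starts F (k + 1) (v (k + 1)) := by
  simp only [starts, Finset.mem_filter, Finset.mem_biUnion, id]
  exact ⟨⟨g 0, h.edge_mem 0 (by omega), h.left_mem 0 (by omega)⟩, v, g, h, rfl, rfl⟩

theorem zero_mem_chords (h : IsNatBergePath F (k + 1) v g) : 0 ∈ chords v g (k + 1) :=
  mem_chords.2 ⟨by omega, h.right_mem 0 (by omega)⟩

theorem zero_mem_fresh (h : IsNatBergePath F (k + 1) v g) : 0 ∈ fresh v g (k + 1) := by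
  simp [fresh, h.zero_mem_chords]

theorem rotate_chord (h : IsNatBergePath F (k + 1) v g) {i : ℕ} (hi : i ∈ chords v g (k + 1))
    {x : V} (hx : x ∈ outer v g (k + 1) i) :
    IsNatBergePath F (k + 1) (rotVertex v i x) (rotEdge g i) :=
  h.rotate (by have := mem_chords.1 hi; omega) (mem_chords.1 hi).2 (mem_outer.1 hx).2
    (mem_outer.1 hx).1

theorem rotVertex_last {i : ℕ} (hi : i ∈ chords v g (k + 1)) (x : V) :
    rotVertex v i x (k + 1) = v (k + 1) := by
  have := (mem_chords.1 hi).1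
  simp [rotVertex, show ¬ k + 1 ≤ i by omega]

theorem pathTail_rotVertex {i : ℕ} (hi : i < k) (x : V) :
    pathTail (rotVertex v i x) k = pathTail v k := by
  ext y
  simp only [mem_pathTail, rotVertex]
  constructor
  · rintro ⟨j, h1, h2, rfl⟩
    rw [if_neg (by omega)]
    split_ifs
    exacts [⟨_, by omega, by omega, rfl⟩, ⟨_, h1, h2, rfl⟩]
  · rintro ⟨j, h1, h2, rfl⟩
    by_cases hj : j ≤ i
    · refine ⟨i + 1 - j, by omega, by omega, ?_⟩
      rw [if_neg (by omega), if_pos (by omega), show i + 1 - (i + 1 - j) = j by omega]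
    · exact ⟨j, h1, h2, by rw [if_neg (by omega), if_neg hj]⟩

theorem outer_rot {i : ℕ} (hi : i < k) (x : V) (j : ℕ) :
    outer (rotVertex v i x) (rotEdge g i) k j = if j ≤ i then outer v g k (i - j) else
      outer v g k j := by
  unfold outer
  rw [pathTail_rotVertex hi]
  unfold rotEdge
  split_ifs <;> rfl

theorem mem_starts_of_mem_outer (h : IsNatBergePath F (k + 1) v g) {i : ℕ}
    (hi : i ∈ chords v g (k + 1)) {x : V} (hx : x ∈ outer v g (k + 1) i) :
    x ∈ starts F (k + 1) (v (k + 1)) := by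
  have := (h.rotate_chord hi hx).mem_starts
  rwa [rotVertex_last hi] at this

theorem mem_starts_of_mem_edge (h : IsNatBergePath F (k + 1) v g) {i : ℕ} (hi : i ≤ k)
    (h0 : v 0 ∈ g i) : v i ∈ starts F (k + 1) (v (k + 1)) := by
  have := (h.reverse_prefix (i := i) (by omega) h0).mem_starts
  simpa [show ¬ k + 1 ≤ i by omega] using this

theorem mem_starts_of_mem_repeats (h : IsNatBergePath F (k + 1) v g) {i : ℕ}
    (hi : i ∈ repeats v g (k + 1)) : v i ∈ starts F (k + 1) (v (k + 1)) := by
  simp only [repeats, Finset.mem_filter] at hi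
  obtain ⟨hi, j, hj, hji, hdis⟩ := hi
  obtain ⟨y, hyj, hyi⟩ := Finset.not_disjoint_iff.1 hdis
  have h2 := (h.rotate_chord hj hyj).mem_starts_of_mem_edge (i := i)
    (by have := mem_chords.1 hi; omega)
    (by simpa [rotVertex, rotEdge, show ¬ i ≤ j by omega] using (mem_outer.1 hyi).1)
  rw [rotVertex_last hj] at h2
  simpa [rotVertex, show ¬ i ≤ j by omega, show i ≠ 0 by omega] using h2

/-- A first vertex lying on a later chord hyperedge makes `v 1` a possible first vertex. -/
theorem one_mem_starts (h : IsNatBergePath F (k + 1) v g) {i : ℕ}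
    (hi : i ∈ chords v g (k + 1)) (hi0 : i ≠ 0) (h0 : v 0 ∈ g i) :
    v 1 ∈ starts F (k + 1) (v (k + 1)) := by
  have hik := (mem_chords.1 hi).1
  have hx : v 0 ∈ outer v g (k + 1) i := by
    refine mem_outer.2 ⟨h0, fun j h1 h2 h3 => ?_⟩
    have := h.vertex_inj _ _ (by omega) h2 h3
    omega
  have h2 := (h.rotate_chord hi hx).mem_starts_of_mem_edge (i := i) (by omega)
    (by simpa [rotVertex, rotEdge] using h.left_mem 0 (by omega))
  rw [rotVertex_last hi] at h2
  simpa [rotVertex, hi0] using h2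

/-- First vertices of rotated paths, counted without repetition. -/
def rotStarts (v : ℕ → V) (g : ℕ → Finset V) (k : ℕ) : Finset V :=
  (fresh v g k).biUnion (outer v g k) ∪ (repeats v g k).image v

theorem rotStarts_subset (h : IsNatBergePath F (k + 1) v g) :
    rotStarts v g (k + 1) ⊆ starts F (k + 1) (v (k + 1)) := by
  intro x hx
  simp only [rotStarts, Finset.mem_union, Finset.mem_biUnion, Finset.mem_image] at hx
  rcases hx with ⟨i, hi, hx⟩ | ⟨i, hi, rfl⟩
  · exact h.mem_starts_of_mem_outer (Finset.mem_filter.1 hi).1 hx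
  · exact h.mem_starts_of_mem_repeats hi

theorem pos_of_mem_repeats {i : ℕ} (hi : i ∈ repeats v g k) : 1 ≤ i ∧ i < k := by
  simp only [repeats, Finset.mem_filter, mem_chords] at hi
  obtain ⟨hi, j, -, hj, -⟩ := hi
  omega

theorem card_rotStarts (h : IsNatBergePath F (k + 1) v g) :
    (rotStarts v g (k + 1)).card =
      ∑ i ∈ fresh v g (k + 1), (outer v g (k + 1) i).card + (repeats v g (k + 1)).card := by
  rw [rotStarts, Finset.card_union_of_disjoint, Finset.card_biUnion, Finset.card_image_of_injOn]
  · intro i hi j hj hij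
    have := pos_of_mem_repeats (Finset.mem_coe.1 hi)
    have := pos_of_mem_repeats (Finset.mem_coe.1 hj)
    exact h.vertex_inj _ _ (by omega) (by omega) hij
  · intro i hi j hj hij
    have hi := Finset.mem_filter.1 (Finset.mem_coe.1 hi)
    have hj := Finset.mem_filter.1 (Finset.mem_coe.1 hj)
    rcases lt_or_gt_of_ne hij with hlt | hlt
    · by_contra hd
      exact hj.2 ⟨i, hi.1, hlt, hd⟩
    · by_contra hd
      exact hi.2 ⟨j, hj.1, hlt, fun hd' => hd hd'.symm⟩
  · rw [Finset.disjoint_left]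
    intro x hx hx'
    simp only [Finset.mem_biUnion, Finset.mem_image] at hx hx'
    obtain ⟨i, -, hx⟩ := hx
    obtain ⟨j, hj, rfl⟩ := hx'
    have := pos_of_mem_repeats hj
    exact (mem_outer.1 hx).2 j (by omega) (by omega) rfl

theorem card_fresh_add_card_repeats :
    (fresh v g k).card + (repeats v g k).card = (chords v g k).card := by
  rw [add_comm]
  exact Finset.card_filter_add_card_filter_not _

theorem edge_zero_inter :
    g 0 ∩ pathTail v k = (chords v g k).image fun i => v (i + 1) := by
  ext x
  simp only [Finset.mem_inter, mem_pathTail, Finset.mem_image, mem_chords]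
  constructor
  · rintro ⟨hx, j, h1, h2, rfl⟩
    exact ⟨j - 1, ⟨by omega, by rwa [Nat.sub_add_cancel h1]⟩, by rw [Nat.sub_add_cancel h1]⟩
  · rintro ⟨i, ⟨hi, hx⟩, rfl⟩
    exact ⟨hx, i + 1, by omega, by omega, rfl⟩

theorem card_outer_zero (h : IsNatBergePath F k v g) :
    (outer v g k 0).card + (chords v g k).card = (g 0).card := by
  rw [← Finset.card_sdiff_add_card_inter (g 0) (pathTail v k), edge_zero_inter,
    Finset.card_image_of_injOn, outer]
  intro i hi j hj hij
  have hi := mem_chords.1 (Finset.mem_coe.1 hi)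
  have hj := mem_chords.1 (Finset.mem_coe.1 hj)
  have := h.vertex_inj _ _ (by omega) (by omega) hij
  omega

end IsNatBergePath

namespace IsAcyclicSystem

open IsNatBergePath

variable {r : ℕ}

/-- Hyperedges of chords avoid the last vertex. -/
theorem last_notMem (hF : IsAcyclicSystem F k r) (h : IsNatBergePath F (k + 1) v g) {i : ℕ}
    (hi : i ∈ chords v g (k + 1)) : v (k + 1) ∉ g i := by
  intro hv
  obtain ⟨hik, hi⟩ := mem_chords.1 hi
  refine hF.not_cycle ⟨_, _, g i, h.rotate_tail (by omega) hi, h.edge_mem i hik, ?_, ?_, ?_⟩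
  · intro j hj
    split_ifs <;> intro hij <;> have := h.edge_inj _ _ (by omega) (by omega) hij <;> omega
  · split_ifs with h0
    · exact h.left_mem i hik
    · obtain rfl : i = 0 := by omega
      exact h.right_mem 0 hik
  · simpa [show ¬ k < i by omega] using hv

theorem edge_subset (hF : IsAcyclicSystem F k r) (h : IsNatBergePath F (k + 1) v g) {i : ℕ}
    (hi : i ∈ chords v g (k + 1)) : g i ⊆ outer v g (k + 1) i ∪ pathTail v k := by
  intro x hx
  by_cases hx' : x ∈ outer v g (k + 1) i
  · exact Finset.mem_union_left _ hx'
  refine Finset.mem_union_right _ (mem_pathTail.2 ?_)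
  have : x ∈ pathTail v (k + 1) := by
    by_contra h1
    exact hx' (Finset.mem_sdiff.2 ⟨hx, h1⟩)
  obtain ⟨j, h1, h2, rfl⟩ := mem_pathTail.1 this
  refine ⟨j, h1, ?_, rfl⟩
  rcases Nat.lt_or_ge k j with h3 | h3
  · obtain rfl : j = k + 1 := by omega
    exact absurd hx (hF.last_notMem h hi)
  · exact h3

theorem card_pathTail_le : (pathTail v k).card ≤ k :=
  Finset.card_image_le.trans (by simp)

theorem outer_nonempty (hF : IsAcyclicSystem F k r) (h : IsNatBergePath F (k + 1) v g) {i : ℕ}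
    (hi : i ∈ chords v g (k + 1)) : 1 ≤ (outer v g (k + 1) i).card := by
  have h1 := Finset.card_le_card (hF.edge_subset h hi)
  have h2 := Finset.card_union_le (outer v g (k + 1) i) (pathTail v k)
  have h3 := card_pathTail_le (v := v) (k := k)
  have h4 := hF.uniform _ (h.edge_mem i (mem_chords.1 hi).1)
  have h5 := hF.le_size
  omega

theorem sum_outer (h : IsNatBergePath F (k + 1) v g) :
    (outer v g (k + 1) 0).card + ∑ i ∈ (fresh v g (k + 1)).erase 0, (outer v g (k + 1) i).card =
      ∑ i ∈ fresh v g (k + 1), (outer v g (k + 1) i).card :=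
  Finset.add_sum_erase _ (fun i => (outer v g (k + 1) i).card) h.zero_mem_fresh

theorem card_erase_fresh_le (hF : IsAcyclicSystem F k r) (h : IsNatBergePath F (k + 1) v g) :
    ((fresh v g (k + 1)).erase 0).card ≤
      ∑ i ∈ (fresh v g (k + 1)).erase 0, (outer v g (k + 1) i).card := by
  rw [Finset.card_eq_sum_ones]
  exact Finset.sum_le_sum fun i hi =>
    hF.outer_nonempty h (Finset.mem_filter.1 (Finset.mem_of_mem_erase hi)).1

theorem size_eq (hF : IsAcyclicSystem F k r) (h : IsNatBergePath F (k + 1) v g) :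
    (outer v g (k + 1) 0).card + ((fresh v g (k + 1)).erase 0).card +
      (repeats v g (k + 1)).card + 1 = r := by
  have h1 := h.card_outer_zero
  have h2 := card_fresh_add_card_repeats (v := v) (g := g) (k := k + 1)
  have h3 := Finset.card_erase_add_one h.zero_mem_fresh
  have h4 := hF.uniform _ (h.edge_mem 0 (by omega))
  omega

theorem size_le_card_rotStarts (hF : IsAcyclicSystem F k r) (h : IsNatBergePath F (k + 1) v g) :
    r ≤ (rotStarts v g (k + 1)).card + 1 := by
  have h1 := hF.size_eq h
  have h2 := hF.card_erase_fresh_le h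
  have h3 := sum_outer h
  have h4 := h.card_rotStarts
  omega

theorem size_le_card_starts (hF : IsAcyclicSystem F k r) (h : IsNatBergePath F (k + 1) v g) :
    r ≤ (starts F (k + 1) (v (k + 1))).card + 1 :=
  (hF.size_le_card_rotStarts h).trans
    (Nat.add_le_add_right (Finset.card_le_card h.rotStarts_subset) 1)

variable (hF : IsAcyclicSystem F k r) {w : V} (hlt : (starts F (k + 1) w).card < r)
  (hdeg : ∀ x ∈ starts F (k + 1) w, 2 ≤ (F.filter (x ∈ ·)).card)

section

include hF hlt

theorem rotStarts_eq (h : IsNatBergePath F (k + 1) v g) (hw : v (k + 1) = w) :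
    rotStarts v g (k + 1) = starts F (k + 1) w := by
  subst hw
  refine Finset.eq_of_subset_of_card_le h.rotStarts_subset ?_
  have := hF.size_le_card_rotStarts h
  omega

theorem card_outer_le_one (h : IsNatBergePath F (k + 1) v g) (hw : v (k + 1) = w) {i : ℕ}
    (hi : i ∈ fresh v g (k + 1)) (hi0 : i ≠ 0) : (outer v g (k + 1) i).card ≤ 1 := by
  have h1 := hF.size_eq h
  have h3 := sum_outer h
  have h4 := h.card_rotStarts
  rw [hF.rotStarts_eq hlt h hw] at h4
  by_contra! h5
  have h6 : ((fresh v g (k + 1)).erase 0).card <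
      ∑ i ∈ (fresh v g (k + 1)).erase 0, (outer v g (k + 1) i).card := by
    rw [Finset.card_eq_sum_ones]
    exact Finset.sum_lt_sum (fun j hj =>
      hF.outer_nonempty h (Finset.mem_filter.1 (Finset.mem_of_mem_erase hj)).1)
      ⟨i, Finset.mem_erase.2 ⟨hi0, hi⟩, h5⟩
  omega

/-- The interior vertices of the path among the possible first vertices. -/
theorem mem_starts_iff (h : IsNatBergePath F (k + 1) v g) (hw : v (k + 1) = w) {i : ℕ}
    (hi : 1 ≤ i) (hik : i ≤ k) : v i ∈ starts F (k + 1) w ↔ i ∈ repeats v g (k + 1) := by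
  refine ⟨fun hv => ?_, fun hv => hw ▸ h.mem_starts_of_mem_repeats hv⟩
  rw [← hF.rotStarts_eq hlt h hw] at hv
  simp only [rotStarts, Finset.mem_union, Finset.mem_biUnion, Finset.mem_image] at hv
  rcases hv with ⟨j, -, hj⟩ | ⟨j, hj, hji⟩
  · exact absurd rfl ((mem_outer.1 hj).2 i hi (by omega))
  · have := pos_of_mem_repeats hj
    rwa [← h.vertex_inj j i (by omega) (by omega) hji]

theorem exists_fresh (h : IsNatBergePath F (k + 1) v g) (hw : v (k + 1) = w) {i : ℕ}
    (hi : i ∈ chords v g (k + 1)) {x : V} (hx : x ∈ outer v g (k + 1) i) :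
    ∃ j ∈ fresh v g (k + 1), x ∈ outer v g (k + 1) j := by
  have hs := h.mem_starts_of_mem_outer hi hx
  rw [hw, ← hF.rotStarts_eq hlt h hw] at hs
  simp only [rotStarts, Finset.mem_union, Finset.mem_biUnion, Finset.mem_image] at hs
  rcases hs with hs | ⟨j, hj, rfl⟩
  · exact hs
  · have := pos_of_mem_repeats hj
    exact absurd rfl ((mem_outer.1 hx).2 j (by omega) (by omega))

end

include hF hlt hdeg

theorem one_mem_repeats (h : IsNatBergePath F (k + 1) v g) (hw : v (k + 1) = w) :
    1 ∈ repeats v g (k + 1) := by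
  have hv0 : v 0 ∈ starts F (k + 1) w := hw ▸ h.mem_starts
  obtain ⟨e, he, hne⟩ := Finset.exists_mem_ne (hdeg _ hv0) (g 0)
  rw [Finset.mem_filter, ← h.image_edge hF.card_eq, Finset.mem_image] at he
  obtain ⟨⟨i, hi, rfl⟩, hvi⟩ := he
  have hik := Finset.mem_range.1 hi
  have hi0 : i ≠ 0 := by rintro rfl; exact hne rfl
  have hs := h.mem_starts_of_mem_edge (by omega) hvi
  rw [hw, hF.mem_starts_iff hlt h hw (by omega) (by omega)] at hs
  have h1 := h.one_mem_starts (Finset.mem_filter.1 hs).1 hi0 hvi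
  rwa [hw, hF.mem_starts_iff hlt h hw le_rfl (by omega)] at h1

theorem outer_one_subset (h : IsNatBergePath F (k + 1) v g) (hw : v (k + 1) = w) :
    outer v g (k + 1) 1 ⊆ outer v g (k + 1) 0 := by
  intro x hx
  have h1 := hF.one_mem_repeats hlt hdeg h hw
  have hc := (Finset.mem_filter.1 h1).1
  obtain ⟨j, hj, hxj⟩ := hF.exists_fresh hlt h hw hc hx
  rw [fresh, Finset.mem_filter] at hj
  rcases Nat.lt_trichotomy j 1 with h2 | rfl | h2
  · obtain rfl : j = 0 := by omega
    exact hxj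
  · exact absurd (Finset.mem_filter.1 h1).2 hj.2
  · exact absurd ⟨1, hc, h2, Finset.not_disjoint_iff.2 ⟨x, hx, hxj⟩⟩ hj.2

theorem outer_one_eq (h : IsNatBergePath F (k + 1) v g) (hw : v (k + 1) = w) :
    outer v g (k + 1) 1 = outer v g (k + 1) 0 := by
  refine (hF.outer_one_subset hlt hdeg h hw).antisymm ?_
  have h1 := hF.one_mem_repeats hlt hdeg h hw
  have hc := (Finset.mem_filter.1 h1).1
  have hk := (mem_chords.1 hc).1
  obtain ⟨y, hy⟩ := Finset.card_pos.1 (hF.outer_nonempty h hc)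
  have := hF.outer_one_subset hlt hdeg (h.rotate_chord hc hy) ((rotVertex_last hc y).trans hw)
  rw [outer_rot hk, outer_rot hk] at this
  simpa using this

theorem two_le_card_outer_zero (h : IsNatBergePath F (k + 1) v g) (hw : v (k + 1) = w) :
    2 ≤ (outer v g (k + 1) 0).card := by
  have h1 := hF.one_mem_repeats hlt hdeg h hw
  have hc := (Finset.mem_filter.1 h1).1
  have hk := (mem_chords.1 hc).1
  by_contra! hcard
  have key : ∀ i < k + 1, g i ⊆ outer v g (k + 1) 0 ∪ pathTail v k →
      g i = outer v g (k + 1) 0 ∪ pathTail v k := by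
    intro i hi hsub
    refine Finset.eq_of_subset_of_card_le hsub ?_
    have h2 := Finset.card_union_le (outer v g (k + 1) 0) (pathTail v k)
    have h3 := card_pathTail_le (v := v) (k := k)
    have h4 := hF.uniform _ (h.edge_mem i hi)
    have h5 := hF.le_size
    omega
  have e0 := key 0 (by omega) (hF.edge_subset h h.zero_mem_chords)
  have e1 := key 1 hk (hF.outer_one_eq hlt hdeg h hw ▸ hF.edge_subset h hc)
  have := h.edge_inj 0 1 (by omega) hk (e0.trans e1.symm)
  omega

theorem mem_repeats_iff (h : IsNatBergePath F (k + 1) v g) (hw : v (k + 1) = w) {i : ℕ}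
    (hi : i ≠ 0) : i ∈ repeats v g (k + 1) ↔ i ∈ chords v g (k + 1) := by
  refine ⟨fun h1 => (Finset.mem_filter.1 h1).1, fun hc => ?_⟩
  by_contra hr
  have hfr : i ∈ fresh v g (k + 1) :=
    Finset.mem_filter.2 ⟨hc, fun h1 => hr (Finset.mem_filter.2 ⟨hc, h1⟩)⟩
  have h1 := hF.card_outer_le_one hlt h hw hfr hi
  obtain ⟨y, hy⟩ := Finset.card_pos.1 (hF.outer_nonempty h hc)
  have h2 := hF.two_le_card_outer_zero hlt hdeg (h.rotate_chord hc hy)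
    ((rotVertex_last hc y).trans hw)
  rw [outer_rot (mem_chords.1 hc).1] at h2
  simp only [Nat.zero_le, if_true, Nat.sub_zero] at h2
  omega

theorem edge_zero_eq_edge_one (h : IsNatBergePath F (k + 1) v g) (hw : v (k + 1) = w) :
    g 0 = g 1 := by
  have hc := (Finset.mem_filter.1 (hF.one_mem_repeats hlt hdeg h hw)).1
  have hk := (mem_chords.1 hc).1
  obtain ⟨y, hy⟩ := Finset.card_pos.1 (hF.outer_nonempty h hc)
  have h' := h.rotate_chord hc hy
  have hw' := (rotVertex_last hc y).trans hw
  have hval : ∀ j, 1 ≤ j → rotVertex v 1 y j = v j := by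
    intro j hj
    rw [rotVertex, if_neg (by omega)]
    split_ifs with h1
    · obtain rfl : j = 1 := by omega
      rfl
    · rfl
  have hmem : ∀ j, 1 ≤ j → j ≤ k → (v (j + 1) ∈ g 0 ↔ v (j + 1) ∈ g 1) := by
    intro j h1 h2
    have e1 := hF.mem_starts_iff hlt h hw h1 h2
    have e2 := hF.mem_starts_iff hlt h' hw' h1 h2
    rw [hval j h1, e1, hF.mem_repeats_iff hlt hdeg h hw (by omega),
      hF.mem_repeats_iff hlt hdeg h' hw' (by omega), mem_chords, mem_chords,
      hval (j + 1) (by omega)] at e2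
    simpa [rotEdge, show j < k + 1 by omega] using e2
  have hinter : g 0 ∩ pathTail v (k + 1) = g 1 ∩ pathTail v (k + 1) := by
    ext x
    simp only [Finset.mem_inter, mem_pathTail]
    refine and_congr_left ?_
    rintro ⟨j, h1, h2, rfl⟩
    rcases Nat.lt_or_ge 1 j with h3 | h3
    · have := hmem (j - 1) (by omega) (by omega)
      rwa [Nat.sub_add_cancel h1] at this
    · obtain rfl : j = 1 := by omega
      exact iff_of_true (h.right_mem 0 (by omega)) (h.left_mem 1 hk)
  have houter := hF.outer_one_eq hlt hdeg h hw
  rw [outer, outer] at houter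
  rw [← Finset.sdiff_union_inter (g 0) (pathTail v (k + 1)), ← houter, hinter,
    Finset.sdiff_union_inter]

omit hlt

/-- If every possible first vertex has degree at least two, there are at least `r` of them. -/
theorem size_le_card_starts_of_two_le (h : IsNatBergePath F (k + 1) v g) (hw : v (k + 1) = w) :
    r ≤ (starts F (k + 1) w).card := by
  by_contra! hlt
  have hk := (mem_chords.1 (Finset.mem_filter.1 (hF.one_mem_repeats hlt hdeg h hw)).1).1
  have := h.edge_inj 0 1 (by omega) hk (hF.edge_zero_eq_edge_one hlt hdeg h hw)
  omega

end IsAcyclicSystem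

/-- `x` is the first vertex of a Berge path of length `k` in `F`. -/
def IsFirstVertex (F : Finset (Finset V)) (k : ℕ) (x : V) : Prop :=
  ∃ v g, IsNatBergePath F k v g ∧ v 0 = x

namespace IsNatBergePath

omit [DecidableEq V] in
theorem isFirstVertex_of_cons (h : IsNatBergePath F k v g) {x : V} {e : Finset V}
    (hx : ∀ i ≤ k, x ≠ v i) (he : e ∈ F) (hge : ∀ i < k, e ≠ g i) (hxe : x ∈ e) (h0 : v 0 ∈ e)
    (hk : v k ∈ e) :
    IsFirstVertex F (k + 1) x ∧ IsFirstVertex F (k + 1) (v 0) ∧ IsFirstVertex F (k + 1) (v k) := by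
  have h' := h.reverse.cons (x := x) (e := e) (fun i _ => hx _ (by omega)) he
    (fun i _ => hge _ (by omega)) hxe (by simpa using hk)
  have h1 := h.cons hx he hge hxe h0
  exact ⟨⟨_, _, h1, rfl⟩, ⟨_, _, h'.reverse, by simp⟩, ⟨_, _, h1.reverse, by simp⟩⟩

omit [DecidableEq V] in
/-- Opening a Berge cycle at one of its hyperedges. -/
theorem exists_open_at_edge (h : IsNatBergePath E k v g) {e : Finset V} (he : e ∈ E)
    (hge : ∀ i < k, e ≠ g i) (h0 : v 0 ∈ e) (hk : v k ∈ e) {j : ℕ} (hj : j < k) :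
    ∃ v' g', IsNatBergePath E k v' g' ∧ v' 0 = v (j + 1) ∧ v' k = v j ∧
      (∀ i ≤ k, ∃ i' ≤ k, v' i = v i') ∧ ∀ i < k, g j ≠ g' i := by
  obtain ⟨v', g', h', h1, h2, h3, h4⟩ := h.open_cycle he hge h0 hk hj
  refine ⟨v', g', h', h1, h2, h3, fun i hi hij => ?_⟩
  rcases h4 i hi with h5 | ⟨i', hi', hne, h5⟩
  · exact hge j hj (h5.symm.trans hij.symm)
  · exact hne (h.edge_inj _ _ hi' hj (h5.symm.trans hij.symm))

/-- The vertices `v 0, …, v k`. -/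
def support (v : ℕ → V) (k : ℕ) : Finset V := (Finset.range (k + 1)).image v

theorem mem_support {x : V} : x ∈ support v k ↔ ∃ i ≤ k, v i = x := by
  simp [support]

theorem notMem_support {x : V} : x ∉ support v k ↔ ∀ i ≤ k, x ≠ v i := by
  simp [mem_support, eq_comm]

theorem card_support (h : IsNatBergePath E k v g) : (support v k).card = k + 1 := by
  rw [support, Finset.card_image_of_injOn, Finset.card_range]
  intro i hi j hj hij
  have hi := Finset.mem_range.1 (Finset.mem_coe.1 hi)
  have hj := Finset.mem_range.1 (Finset.mem_coe.1 hj)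
  exact h.vertex_inj _ _ (by omega) (by omega) hij

variable {r : ℕ}

theorem isFirstVertex_of_mem_edge_of_cycle (h : IsNatBergePath F k v g) {e : Finset V} (he : e ∈ F)
    (hge : ∀ i < k, e ≠ g i) (h0 : v 0 ∈ e) (hk : v k ∈ e) {j : ℕ} (hj : j < k) {x : V}
    (hxs : x ∉ support v k) (hx : x ∈ g j) :
    IsFirstVertex F (k + 1) x ∧ IsFirstVertex F (k + 1) (v j) ∧
      IsFirstVertex F (k + 1) (v (j + 1)) := by
  obtain ⟨v', g', h', h1, h2, h3, h4⟩ := h.exists_open_at_edge he hge h0 hk hj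
  have := h'.isFirstVertex_of_cons (x := x) (e := g j) ?_ (h.edge_mem j hj) h4 hx
    (h1 ▸ h.right_mem j hj) (h2 ▸ h.left_mem j hj)
  · rw [h1, h2] at this
    exact ⟨this.1, this.2.2, this.2.1⟩
  · intro i hi
    obtain ⟨i', hi', h5⟩ := h3 i hi
    rw [h5]
    exact notMem_support.1 hxs _ hi'

end IsNatBergePath

open IsNatBergePath

variable {r : ℕ}

/-- If `F` consists of the hyperedges of a Berge cycle, every vertex is the first vertex of a Berge
path through all of `F`. -/
theorem HasBergeCycle.isFirstVertex (hc : HasBergeCycle F k) (hF : F.card = k + 1)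
    (hkr : k + 1 ≤ r) (hr : 2 ≤ r) (hu : ∀ e ∈ F, e.card = r) {f : Finset V} (hf : f ∈ F) {x : V}
    (hx : x ∈ f) : IsFirstVertex F (k + 1) x := by
  obtain ⟨v, g, e, h, he, hge, h0, hk⟩ := hc
  have hcard := h.card_support
  have hout : ∀ d ∈ F, ∀ d' ∈ F, d ≠ d' → d ⊆ support v k → d' ⊆ support v k → False := by
    intro d hd d' hd' hne h1 h2
    refine hne ((Finset.eq_of_subset_of_card_le h1 ?_).trans
      (Finset.eq_of_subset_of_card_le h2 ?_).symm)
    · rw [hu d hd]; omega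
    · rw [hu d' hd']; omega
  have hedge : ∀ d ∈ F, d = e ∨ ∃ j < k, d = g j := by
    have hins : insert e ((Finset.range k).image g) = F := by
      apply Finset.eq_of_subset_of_card_le
      · intro d hd
        simp only [Finset.mem_insert, Finset.mem_image, Finset.mem_range] at hd
        rcases hd with rfl | ⟨i, hi, rfl⟩
        exacts [he, h.edge_mem i hi]
      · rw [Finset.card_insert_of_notMem, Finset.card_image_of_injOn, Finset.card_range, hF]
        · intro i hi j hj hij
          exact h.edge_inj i j (by simpa using hi) (by simpa using hj) hij
        · simp only [Finset.mem_image, Finset.mem_range, not_exists, not_and]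
          exact fun i hi hij => hge i hi hij.symm
    intro d hd
    rw [← hins] at hd
    simp only [Finset.mem_insert, Finset.mem_image, Finset.mem_range] at hd
    rcases hd with rfl | ⟨i, hi, rfl⟩
    exacts [Or.inl rfl, Or.inr ⟨i, hi, rfl⟩]
  have he' : ∀ y ∈ e, y ∉ support v k → IsFirstVertex F (k + 1) y ∧
      IsFirstVertex F (k + 1) (v 0) ∧ IsFirstVertex F (k + 1) (v k) := fun y hy hys =>
    h.isFirstVertex_of_cons (notMem_support.1 hys) he hge hy h0 hk
  by_cases hxs : x ∈ support v k
  · obtain ⟨j, hj, rfl⟩ := mem_support.1 hxs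
    have hleft : e ⊆ support v k → j < k → ¬ g j ⊆ support v k := fun h1 h2 h3 =>
      hout e he _ (h.edge_mem j h2) (hge j h2) h1 h3
    have hg : ∀ i < k, (j = i ∨ j = i + 1) → ¬ g i ⊆ support v k →
        IsFirstVertex F (k + 1) (v j) := by
      intro i hi hij hsub
      obtain ⟨y, hy, hys⟩ := Finset.not_subset.1 hsub
      have := h.isFirstVertex_of_mem_edge_of_cycle he hge h0 hk hi hys hy
      rcases hij with rfl | rfl
      exacts [this.2.1, this.2.2]
    by_cases hes : e ⊆ support v k
    · rcases Nat.lt_or_ge j k with h1 | h1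
      · exact hg j h1 (Or.inl rfl) (hleft hes h1)
      · obtain rfl : j = k := by omega
        rcases Nat.eq_zero_or_pos j with rfl | hpos
        · have := Finset.card_le_card hes
          rw [hu e he] at this
          omega
        · exact hg (j - 1) (by omega) (Or.inr (by omega)) fun h2 =>
            hout e he _ (h.edge_mem (j - 1) (by omega)) (hge _ (by omega)) hes h2
    · obtain ⟨y, hy, hys⟩ := Finset.not_subset.1 hes
      have := he' y hy hys
      rcases Nat.eq_zero_or_pos j with rfl | hpos
      · exact this.2.1
      rcases Nat.lt_or_ge j k with h1 | h1
      · by_cases h2 : g j ⊆ support v k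
        · refine hg (j - 1) (by omega) (Or.inr (by omega)) fun h3 =>
            hout _ (h.edge_mem j h1) _ (h.edge_mem (j - 1) (by omega)) (fun h4 => ?_) h2 h3
          have := h.edge_inj _ _ h1 (by omega) h4
          omega
        · exact hg j h1 (Or.inl rfl) h2
      · obtain rfl : j = k := by omega
        exact this.2.2
  · rcases hedge f hf with rfl | ⟨j, hj, rfl⟩
    · exact (he' x hx hxs).1
    · exact (h.isFirstVertex_of_mem_edge_of_cycle he hge h0 hk hj hxs hx).1

namespace IsNatBergePath

/-- If no Berge path is longer than a Berge cycle minus one hyperedge, the vertex set of the cycle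
is a union of components. -/
theorem subset_support_of_cycle (h : IsNatBergePath E k v g) {e : Finset V} (he : e ∈ E)
    (hge : ∀ i < k, e ≠ g i) (h0 : v 0 ∈ e) (hk : v k ∈ e)
    (hmax : ∀ v g, ¬ IsNatBergePath E (k + 1) v g) {d : Finset V} (hd : d ∈ E) {j : ℕ}
    (hj : j ≤ k) (hjd : v j ∈ d) : d ⊆ support v k := by
  intro x hx
  by_contra hxs
  have hxv := notMem_support.1 hxs
  have key : ∀ v' g', IsNatBergePath E k v' g' → (∀ i ≤ k, ∃ i' ≤ k, v' i = v i') →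
      (∀ i < k, d ≠ g' i) → v' 0 ∉ d := by
    intro v' g' h' h1 h2 h3
    refine hmax _ _ (h'.cons (x := x) (fun i hi => ?_) hd h2 hx h3)
    obtain ⟨i', hi', h4⟩ := h1 i hi
    rw [h4]
    exact hxv i' hi'
  by_cases hdg : ∃ i < k, d = g i
  · obtain ⟨i, hi, rfl⟩ := hdg
    obtain ⟨v', g', h', h1, h2, h3, h4⟩ := h.exists_open_at_edge he hge h0 hk hi
    exact key v' g' h' h3 h4 (h1 ▸ h.right_mem i hi)
  push Not at hdg
  have hv0 := key v g h (fun i hi => ⟨i, hi, rfl⟩) hdg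
  rcases Nat.eq_zero_or_pos j with rfl | hpos
  · exact hv0 hjd
  obtain ⟨v', g', h', h1, h2, h3, h4⟩ := h.open_cycle he hge h0 hk (j := j - 1) (by omega)
  rw [Nat.sub_add_cancel hpos] at h1
  refine key v' g' h' h3 (fun i hi hij => ?_) (h1 ▸ hjd)
  rcases h4 i hi with h5 | ⟨i', hi', -, h5⟩
  · exact hv0 (by rwa [hij, h5])
  · exact hdg i' hi' (hij.trans h5)

theorem eq_image_of_first_mem (h : IsNatBergePath E k v g) (hkr : k ≤ r)
    (hu : ∀ e ∈ E, e.card = r) (hmax : ∀ v g, ¬ IsNatBergePath E (k + 1) v g)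
    (hcyc : ¬ HasBergeCycle E k) {d : Finset V} (hd : d ∈ E) (hdg : ∀ i < k, d ≠ g i)
    (h0 : v 0 ∈ d) : d = (Finset.range k).image v ∧ k = r := by
  have hsub : d ⊆ (Finset.range k).image v := by
    intro x hx
    by_contra hxs
    refine hmax _ _ (h.cons (x := x) (fun i hi hxi => ?_) hd hdg hx h0)
    rcases Nat.lt_or_ge i k with h1 | h1
    · exact hxs (Finset.mem_image.2 ⟨i, Finset.mem_range.2 h1, hxi.symm⟩)
    · obtain rfl : i = k := by omega
      exact hcyc ⟨v, g, d, h, hd, hdg, h0, hxi ▸ hx⟩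
  have h1 : ((Finset.range k).image v).card ≤ k := Finset.card_image_le.trans (by simp)
  have h2 := Finset.card_le_card hsub
  have h3 := hu d hd
  exact ⟨Finset.eq_of_subset_of_card_le hsub (by omega), by omega⟩

/-- In the absence of longer Berge paths and cycles, the first vertex of a longest Berge path lies
on hyperedges of the path only. -/
theorem exists_eq_of_first_mem (h : IsNatBergePath E k v g) (hk : 1 ≤ k) (hkr : k ≤ r)
    (hr : 2 ≤ r) (hu : ∀ e ∈ E, e.card = r) (hmax : ∀ v g, ¬ IsNatBergePath E (k + 1) v g)
    (hcyc : ¬ HasBergeCycle E k) {d : Finset V} (hd : d ∈ E) (h0 : v 0 ∈ d) :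
    ∃ i < k, d = g i := by
  by_contra! hdg
  obtain ⟨h1, h2⟩ := h.eq_image_of_first_mem hkr hu hmax hcyc hd hdg h0
  have hv1 : v 1 ∈ d := by
    rw [h1]
    exact Finset.mem_image.2 ⟨1, Finset.mem_range.2 (by omega), rfl⟩
  have h' : IsNatBergePath E k v fun i => if i = 0 then d else g i := by
    refine ⟨h.vertex_inj, ?_, ?_, ?_, ?_⟩
    · intro i j hi hj hij
      split_ifs at hij
      · omega
      · exact absurd hij (hdg j hj)
      · exact absurd hij.symm (hdg i hi)
      · exact h.edge_inj i j hi hj hij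
    · intro i hi
      split_ifs
      exacts [hd, h.edge_mem i hi]
    · intro i hi
      split_ifs with hi0
      · rwa [hi0]
      · exact h.left_mem i hi
    · intro i hi
      split_ifs with hi0
      · rwa [hi0]
      · exact h.right_mem i hi
  have h3 := h'.eq_image_of_first_mem hkr hu hmax hcyc (h.edge_mem 0 hk) (fun i hi => ?_)
    (h.left_mem 0 hk)
  · exact hdg 0 hk (h1.trans h3.1.symm)
  · split_ifs with hi0
    · exact (hdg 0 hk).symm
    · intro h4
      exact hi0 (h.edge_inj 0 i hk hi h4).symm

end IsNatBergePath

/-- There are `m` vertices that meet at most `m` hyperedges. -/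
def HasSparseSet (E : Finset (Finset V)) (m : ℕ) : Prop :=
  ∃ D ⊆ E.biUnion id, D.card = m ∧ (E.filter (¬ Disjoint · D)).card ≤ m

theorem HasSparseSet.of_card_le {D : Finset V} {m : ℕ} (hD : D ⊆ E.biUnion id) (hm : m ≤ D.card)
    (hF : F.card ≤ m) (hDF : ∀ x ∈ D, ∀ d ∈ E, x ∈ d → d ∈ F) : HasSparseSet E m := by
  obtain ⟨D', hD', rfl⟩ := Finset.exists_subset_card_eq hm
  refine ⟨D', hD'.trans hD, rfl, (Finset.card_le_card fun d hd => ?_).trans hF⟩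
  obtain ⟨hd, hdis⟩ := Finset.mem_filter.1 hd
  obtain ⟨x, hxd, hx⟩ := Finset.not_disjoint_iff.1 hdis
  exact hDF x (hD' hx) d hd hxd

omit [DecidableEq V] in
theorem exists_isNatBergePath_one (hr : 2 ≤ r) (hu : ∀ e ∈ E, e.card = r) (hE : E.Nonempty) :
    ∃ v g, IsNatBergePath E 1 v g := by
  obtain ⟨e, he⟩ := hE
  obtain ⟨x, hx, y, hy, hxy⟩ := Finset.one_lt_card.1 (by rw [hu e he]; omega : 1 < e.card)
  refine ⟨fun i => if i = 0 then x else y, fun _ => e, ?_, ?_, fun _ _ => he, ?_, ?_⟩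
  · intro i j hi hj hij
    split_ifs at hij
    · omega
    · exact absurd hij hxy
    · exact absurd hij.symm hxy
    · omega
  · intro i j hi hj _
    omega
  · intro i hi
    simpa [show i = 0 by omega] using hx
  · intro i hi
    simpa using hy

omit [DecidableEq V] in
theorem exists_longest_path (hr : 2 ≤ r) (hu : ∀ e ∈ E, e.card = r) (hE : E.Nonempty)
    (hmax : ∀ v g, ¬ IsNatBergePath E (r + 1) v g) :
    ∃ k v g, k + 1 ≤ r ∧ IsNatBergePath E (k + 1) v g ∧
      ∀ v g, ¬ IsNatBergePath E (k + 1 + 1) v g := by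
  classical
  have hex : ∃ m, ∀ v g, ¬ IsNatBergePath E (m + 1 + 1) v g :=
    ⟨r - 1, by rwa [show r - 1 + 1 + 1 = r + 1 by omega]⟩
  have hle : Nat.find hex ≤ r - 1 :=
    Nat.find_min' hex (by rwa [show r - 1 + 1 + 1 = r + 1 by omega])
  have hpath : ∃ v g, IsNatBergePath E (Nat.find hex + 1) v g := by
    rcases Nat.eq_zero_or_pos (Nat.find hex) with h0 | hpos
    · rw [h0]
      exact exists_isNatBergePath_one hr hu hE
    · have := Nat.find_min hex (m := Nat.find hex - 1) (by omega)
      rw [Nat.sub_add_cancel hpos] at this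
      push Not at this
      exact this
  obtain ⟨v, g, h⟩ := hpath
  exact ⟨_, v, g, by omega, h, Nat.find_spec hex⟩

theorem hasSparseSet_of_cycle (hu : ∀ e ∈ E, e.card = r) (hk : 1 ≤ k) (hkr : k ≤ r)
    (hmax : ∀ v g, ¬ IsNatBergePath E (k + 1) v g) (hc : HasBergeCycle E k) :
    HasSparseSet E (r + 1) := by
  obtain ⟨v, g, e, h, he, hge, h0, hk'⟩ := hc
  have hsub : ∀ x ∈ support v k, ∀ d ∈ E, x ∈ d → d ⊆ support v k := by
    intro x hx d hd hxd
    obtain ⟨j, hj, rfl⟩ := mem_support.1 hx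
    exact h.subset_support_of_cycle he hge h0 hk' hmax hd hj hxd
  have hv0 : v 0 ∈ support v k := mem_support.2 ⟨0, by omega, rfl⟩
  have he' := hsub _ hv0 e he h0
  have hg' := hsub _ hv0 (g 0) (h.edge_mem 0 hk) (h.left_mem 0 hk)
  have hcard := h.card_support
  have hkr' : k = r := by
    by_contra hne
    refine hge 0 hk ((Finset.eq_of_subset_of_card_le he' ?_).trans
      (Finset.eq_of_subset_of_card_le hg' ?_).symm)
    · rw [hu e he]; omega
    · rw [hu _ (h.edge_mem 0 hk)]; omega
  subst hkr'
  refine HasSparseSet.of_card_le (D := support v k) (F := (support v k).powersetCard k) ?_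
    hcard.ge ?_ fun x hx d hd hxd => Finset.mem_powersetCard.2 ⟨hsub x hx d hd hxd, hu d hd⟩
  · intro x hx
    obtain ⟨j, hj, rfl⟩ := mem_support.1 hx
    rw [Finset.mem_biUnion]
    rcases Nat.lt_or_ge j k with h1 | h1
    · exact ⟨g j, h.edge_mem j h1, h.left_mem j h1⟩
    · obtain rfl : j = k := by omega
      exact ⟨e, he, hk'⟩
  · rw [Finset.card_powersetCard, hcard, Nat.choose_succ_self_right]

/-- A nonempty `r`-graph without Berge paths of length `r + 1` has a small set of vertices that
meets few hyperedges. -/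
theorem hasSparseSet_of_no_path (hr : 2 ≤ r) (hu : ∀ e ∈ E, e.card = r) (hE : E.Nonempty)
    (hmax : ∀ v g, ¬ IsNatBergePath E (r + 1) v g) :
    HasSparseSet E (r + 1) ∨ HasSparseSet E r ∧ HasSparseSet E 1 := by
  obtain ⟨k, v, g, hkr, h, hmax⟩ := exists_longest_path hr hu hE hmax
  by_cases hcyc : HasBergeCycle E (k + 1)
  · exact Or.inl (hasSparseSet_of_cycle hu (by omega) hkr hmax hcyc)
  obtain ⟨F, hFE, hF, hFp⟩ : ∃ F ⊆ E, F.card = k + 1 ∧ IsNatBergePath F (k + 1) v g := by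
    refine ⟨(Finset.range (k + 1)).image g, ?_, ?_, h.vertex_inj, h.edge_inj, ?_, h.left_mem,
      h.right_mem⟩
    · intro e he
      obtain ⟨i, hi, rfl⟩ := Finset.mem_image.1 he
      exact h.edge_mem i (Finset.mem_range.1 hi)
    · rw [Finset.card_image_of_injOn, Finset.card_range]
      intro i hi j hj hij
      exact h.edge_inj i j (by simpa using hi) (by simpa using hj) hij
    · exact fun i hi => Finset.mem_image_of_mem g (Finset.mem_range.2 hi)
  have huF : ∀ e ∈ F, e.card = r := fun e he => hu e (hFE he)
  have hloc : ∀ x, IsFirstVertex F (k + 1) x → ∀ d ∈ E, x ∈ d → d ∈ F := by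
    rintro _ ⟨v', g', h', rfl⟩ d hd hxd
    obtain ⟨i, hi, rfl⟩ :=
      (h'.mono hFE).exists_eq_of_first_mem (by omega) hkr hr hu hmax hcyc hd hxd
    exact h'.edge_mem i hi
  have hmem : ∀ x, IsFirstVertex F (k + 1) x → x ∈ E.biUnion id := by
    rintro _ ⟨v', g', h', rfl⟩
    exact Finset.mem_biUnion.2 ⟨g' 0, hFE (h'.edge_mem 0 (by omega)), h'.left_mem 0 (by omega)⟩
  have hsparse : ∀ D : Finset V, (∀ x ∈ D, IsFirstVertex F (k + 1) x) → ∀ m, m ≤ D.card →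
      k + 1 ≤ m → HasSparseSet E m := fun D hD m hm hkm =>
    HasSparseSet.of_card_le (fun x hx => hmem x (hD x hx)) hm (hF.le.trans hkm)
      fun x hx => hloc x (hD x hx)
  have hone : ∀ x, IsFirstVertex F (k + 1) x → (F.filter (x ∈ ·)).card ≤ 1 →
      HasSparseSet E 1 := fun x hx hdeg =>
    HasSparseSet.of_card_le (D := {x}) (by simpa using hmem x hx) (by simp) hdeg <| by
      intro y hy d hd hyd
      obtain rfl := Finset.mem_singleton.1 hy
      exact Finset.mem_filter.2 ⟨hloc y hx d hd hyd, hyd⟩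
  by_cases hcF : HasBergeCycle F k
  · have hfirst : ∀ f ∈ F, ∀ x ∈ f, IsFirstVertex F (k + 1) x := fun f hf x hx =>
      hcF.isFirstVertex hF hkr hr huF hf hx
    have h0 := hFp.edge_mem 0 (by omega)
    rcases Nat.eq_zero_or_pos k with rfl | hpos
    · have hx := hfirst _ h0 _ (hFp.left_mem 0 (by omega))
      refine Or.inr ⟨hsparse _ (hfirst _ h0) r (huF _ h0).ge hkr, hone _ hx ?_⟩
      exact (Finset.card_le_card (Finset.filter_subset _ _)).trans hF.le
    · have h1 := hFp.edge_mem 1 (by omega)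
      refine Or.inl (hsparse (g 0 ∪ g 1) ?_ (r + 1) ?_ (by omega))
      · intro x hx
        rcases Finset.mem_union.1 hx with hx | hx
        exacts [hfirst _ h0 x hx, hfirst _ h1 x hx]
      · by_contra! hlt
        have e0 := Finset.eq_of_subset_of_card_le (Finset.subset_union_left (s₁ := g 0) (s₂ := g 1))
          (by rw [huF _ h0]; omega)
        have e1 := Finset.eq_of_subset_of_card_le
          (Finset.subset_union_right (s₁ := g 0) (s₂ := g 1)) (by rw [huF _ h1]; omega)
        have := hFp.edge_inj 0 1 (by omega) (by omega) (e0.trans e1.symm)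
        omega
  have hA : IsAcyclicSystem F k r := ⟨hF, hkr, huF, hcF⟩
  have hstart : ∀ x ∈ starts F (k + 1) (v (k + 1)), IsFirstVertex F (k + 1) x := by
    intro x hx
    obtain ⟨v', g', h', h0, -⟩ := exists_path_of_mem_starts hx
    exact ⟨v', g', h', h0⟩
  have hlast : v (k + 1) ∉ starts F (k + 1) (v (k + 1)) := by
    intro hx
    obtain ⟨v', g', h', h0, h1⟩ := exists_path_of_mem_starts hx
    have := h'.vertex_inj _ _ (by omega) le_rfl (h0.trans h1.symm)
    omega
  have hins : ∀ x ∈ insert (v (k + 1)) (starts F (k + 1) (v (k + 1))),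
      IsFirstVertex F (k + 1) x := by
    intro x hx
    rcases Finset.mem_insert.1 hx with rfl | hx
    exacts [⟨_, _, hFp.reverse, by simp⟩, hstart x hx]
  have hcard := Finset.card_insert_of_notMem hlast
  by_cases hdeg : ∀ x ∈ starts F (k + 1) (v (k + 1)), 2 ≤ (F.filter (x ∈ ·)).card
  · have := hA.size_le_card_starts_of_two_le hdeg hFp rfl
    exact Or.inl (hsparse _ hins _ (by omega) (by omega))
  · push Not at hdeg
    obtain ⟨x, hx, hdeg⟩ := hdeg
    have := hA.size_le_card_starts hFp
    exact Or.inr ⟨hsparse _ hins _ (by omega) hkr, hone x (hstart x hx) (by omega)⟩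

end BergePaths

/-- The number of hyperedges of the extremal `r`-graph on `n` vertices. -/
def blockBound (r n : ℕ) : ℕ := n / (r + 1) * (r + 1) + (n % (r + 1)).choose r

theorem blockBound_mul_add (r p : ℕ) {q : ℕ} (hq : q < r + 1) :
    blockBound r (p * (r + 1) + q) = p * (r + 1) + q.choose r := by
  rw [blockBound, mul_comm p, Nat.mul_add_div (by omega), Nat.mul_add_mod,
    Nat.div_eq_of_lt hq, Nat.mod_eq_of_lt hq, add_zero, mul_comm p]

theorem blockBound_add (r n : ℕ) : blockBound r (n + (r + 1)) = blockBound r n + (r + 1) := by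
  rw [blockBound, blockBound, Nat.add_div_right _ (by omega), Nat.add_mod_right]
  ring

theorem le_blockBound_of_le {r n a : ℕ} (hn : r + 1 ≤ n) (hb : a ≤ blockBound r (n - r) + r)
    (hc : a ≤ blockBound r (n - 1) + 1) : a ≤ blockBound r n := by
  obtain ⟨p, q, hq, rfl⟩ : ∃ p q, q < r + 1 ∧ n = p * (r + 1) + q :=
    ⟨n / (r + 1), n % (r + 1), Nat.mod_lt _ (by omega), by rw [mul_comm, Nat.div_add_mod]⟩
  rw [blockBound_mul_add r p hq]
  rcases Nat.lt_or_ge q r with h1 | h1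
  · obtain ⟨p, rfl⟩ : ∃ p', p = p' + 1 := by
      refine ⟨p - 1, ?_⟩
      rcases Nat.eq_zero_or_pos p with rfl | h2 <;> omega
    rw [show (p + 1) * (r + 1) + q - r = p * (r + 1) + (q + 1) by
      rw [add_mul, one_mul]; omega, blockBound_mul_add r p (by omega)] at hb
    have h2 : (q + 1).choose r ≤ 1 := by
      rcases Nat.lt_or_ge (q + 1) r with h3 | h3
      · simp [Nat.choose_eq_zero_of_lt h3]
      · simp [show q + 1 = r by omega]
    rw [add_mul, one_mul]
    omega
  · obtain rfl : q = r := by omega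
    rcases Nat.eq_zero_or_pos q with rfl | h2
    · simp [blockBound] at hb ⊢
      omega
    rw [show p * (q + 1) + q - 1 = p * (q + 1) + (q - 1) by omega,
      blockBound_mul_add q p (by omega), Nat.choose_eq_zero_of_lt (by omega : q - 1 < q)] at hc
    rw [Nat.choose_self]
    omega

section Extremal

variable {V : Type*} [DecidableEq V] {E : Finset (Finset V)} {r : ℕ}

/-- Deleting the vertices of a sparse set. -/
theorem HasSparseSet.card_le {S : Finset V} {m : ℕ} (h : HasSparseSet E m) (hES : ∀ e ∈ E, e ⊆ S)
    {b : ℕ} (hb : ∀ E' ⊆ E, ∀ S' : Finset V, S'.card = S.card - m → (∀ e ∈ E', e ⊆ S') →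
      E'.card ≤ b) : E.card ≤ b + m := by
  obtain ⟨D, hD, rfl, hmeet⟩ := h
  have hDS : D ⊆ S := by
    intro x hx
    obtain ⟨e, he, hxe⟩ := Finset.mem_biUnion.1 (hD hx)
    exact hES e he hxe
  have h1 := hb (E.filter (Disjoint · D)) (Finset.filter_subset _ _) (S \ D)
    (Finset.card_sdiff_of_subset hDS) fun e he =>
      Finset.subset_sdiff.2 ⟨hES e (Finset.mem_filter.1 he).1, (Finset.mem_filter.1 he).2⟩
  rw [← Finset.card_filter_add_card_filter_not (s := E) (Disjoint · D)]
  exact Nat.add_le_add h1 hmeet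

theorem card_le_blockBound (hr : 2 ≤ r) (S : Finset V) (hES : ∀ e ∈ E, e ⊆ S)
    (hu : ∀ e ∈ E, e.card = r) (hmax : ∀ v g, ¬ IsNatBergePath E (r + 1) v g) :
    E.card ≤ blockBound r S.card := by
  induction hn : S.card using Nat.strong_induction_on generalizing S E with
  | _ n ih =>
    subst hn
    rcases E.eq_empty_or_nonempty with rfl | hE
    · simp
    rcases Nat.lt_or_ge S.card (r + 1) with hlt | hge
    · have h1 : E ⊆ S.powersetCard r := fun e he =>
        Finset.mem_powersetCard.2 ⟨hES e he, hu e he⟩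
      have h2 := Finset.card_le_card h1
      rw [Finset.card_powersetCard] at h2
      simpa [blockBound, Nat.div_eq_of_lt hlt, Nat.mod_eq_of_lt hlt] using h2
    have key : ∀ m, 1 ≤ m → HasSparseSet E m → E.card ≤ blockBound r (S.card - m) + m :=
      fun m hm h => h.card_le hES fun E' hE' S' hS' hES' =>
        ih _ (by omega) S' hES' (fun e he => hu e (hE' he))
          (fun v g hp => hmax v g (hp.mono hE')) hS'
    rcases hasSparseSet_of_no_path hr hu hE hmax with h | ⟨h, h'⟩
    · have := key _ (by omega) h
      rwa [← blockBound_add, Nat.sub_add_cancel hge] at this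
    · exact le_blockBound_of_le hge (key _ (by omega) h) (key _ le_rfl h')

end Extremal

/-- The `b`-th block of `r + 1` consecutive vertices. -/
def vertexBlock (r n b : ℕ) : Finset (Fin n) := Finset.univ.filter fun x => x.val / (r + 1) = b

theorem mem_vertexBlock {r n b : ℕ} {x : Fin n} :
    x ∈ vertexBlock r n b ↔ x.val / (r + 1) = b := by
  simp [vertexBlock]

theorem card_vertexBlock (r n b : ℕ) :
    (vertexBlock r n b).card = min n ((b + 1) * (r + 1)) - b * (r + 1) := by
  rw [← Nat.card_Ico, ← Finset.card_map Fin.valEmbedding]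
  congr 1
  ext i
  simp only [Finset.mem_map, mem_vertexBlock, Fin.valEmbedding_apply, Finset.mem_Ico, lt_min_iff,
    Nat.div_eq_iff (by omega : 0 < r + 1), add_mul b 1, one_mul]
  constructor
  · rintro ⟨x, hx, rfl⟩
    omega
  · intro hi
    exact ⟨⟨i, hi.2.1⟩, by dsimp only; omega, rfl⟩

/-- All `r`-sets inside the first `p + 1` blocks. -/
def blockGraph (r n p : ℕ) : Finset (Finset (Fin n)) :=
  (Finset.range (p + 1)).biUnion fun b => (vertexBlock r n b).powersetCard r

theorem mem_blockGraph {r n p : ℕ} {e : Finset (Fin n)} :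
    e ∈ blockGraph r n p ↔ ∃ b < p + 1, e ⊆ vertexBlock r n b ∧ e.card = r := by
  simp [blockGraph, Finset.mem_powersetCard]

theorem card_blockGraph {r p q : ℕ} (hr : 1 ≤ r) (hq : q < r + 1) :
    (blockGraph r (p * (r + 1) + q) p).card = p * (r + 1) + q.choose r := by
  rw [blockGraph, Finset.card_biUnion, Finset.sum_range_succ, Finset.card_powersetCard,
    card_vertexBlock, Finset.sum_congr rfl (g := fun _ => r + 1), Finset.sum_const,
    Finset.card_range, smul_eq_mul, add_mul p 1, one_mul,
    min_eq_left (by omega), Nat.add_sub_cancel_left]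
  · intro b hb
    have h1 : (b + 1) * (r + 1) ≤ p * (r + 1) :=
      Nat.mul_le_mul_right _ (Finset.mem_range.1 hb)
    rw [Finset.card_powersetCard, card_vertexBlock, min_eq_right (by omega), add_mul b 1, one_mul,
      Nat.add_sub_cancel_left, Nat.choose_succ_self_right]
  · intro b _ c _ hbc
    rw [Function.onFun, Finset.disjoint_left]
    intro e heb hec
    rw [Finset.mem_powersetCard] at heb hec
    obtain ⟨x, hx⟩ := Finset.card_pos.1 (by omega : 0 < e.card)
    exact hbc ((mem_vertexBlock.1 (heb.1 hx)).symm.trans (mem_vertexBlock.1 (hec.1 hx)))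

theorem not_hasBergePath_blockGraph (r n p : ℕ) : ¬ HasBergePath (blockGraph r n p) (r + 1) := by
  rintro ⟨v, g, hv, -, hg, hvg⟩
  have hstep : ∀ i : Fin (r + 1), (v i.succ).val / (r + 1) = (v i.castSucc).val / (r + 1) := by
    intro i
    obtain ⟨b, -, hb, -⟩ := mem_blockGraph.1 (hg i)
    rw [mem_vertexBlock.1 (hb (hvg i).1), mem_vertexBlock.1 (hb (hvg i).2)]
  have hall : ∀ i, v i ∈ vertexBlock r n ((v 0).val / (r + 1)) := by
    intro i
    rw [mem_vertexBlock]
    induction i using Fin.induction with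
    | zero => rfl
    | succ i ih => rw [hstep i, ih]
  have h1 := Finset.card_le_card_of_injOn (s := Finset.univ) v (fun i _ => hall i) hv.injOn
  rw [Finset.card_univ, Fintype.card_fin, card_vertexBlock, add_mul _ 1, one_mul] at h1
  omega

/-- For `r ≥ 3` and `n = p(r+1) + q` with `0 ≤ q < r+1`, the maximum number of
hyperedges of an `n`-vertex `r`-uniform hypergraph with no Berge path of length
`r+1` equals `p(r+1) + C(q,r)`. -/
theorem berge_path_turan_k_eq_r_add_one (r p q n : ℕ) (hr : 3 ≤ r)
    (hn : n = p * (r + 1) + q) (hq : q < r + 1) :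
    IsGreatest {m : ℕ | ∃ E : Finset (Finset (Fin n)),
        (∀ e ∈ E, e.card = r) ∧ ¬ HasBergePath E (r + 1) ∧ E.card = m}
      (p * (r + 1) + Nat.choose q r) := by
  subst hn
  refine ⟨⟨blockGraph r _ p, fun e he => ?_, not_hasBergePath_blockGraph r _ p,
    card_blockGraph (by omega) hq⟩, ?_⟩
  · obtain ⟨b, -, -, he⟩ := mem_blockGraph.1 he
    exact he
  · rintro m ⟨E, hu, hpath, rfl⟩
    have := card_le_blockBound (E := E) (by omega) Finset.univ (fun e _ => Finset.subset_univ e) hu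
      fun v g h => hpath h.hasBergePath
    rwa [Finset.card_univ, Fintype.card_fin, blockBound_mul_add r p hq] at this
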